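/- Let f: Ω → ℝ be a continuous potential in the Walters class, i.e., sup_{n≥1} sup_{a ∈ A^n} |S_n(f)(ax) − S_n(f)(ay)| → 0 as d_Ω(x,y) → 0, where ax denotes the concatenation of the finite word a with x. Suppose λ > 0 and a strictly positive continuous function h satisfy L_f h = λ h, and set f̄ = f + log h − log(h∘σ) − log λ; let ν be a Borel probability measure with L_{f̄}* ν = ν. Then for every shift-invariant Borel probability measure μ on Ω, lim_{n→∞} (1/n) H_{Λ_n}(μ | ν) exists in [0,+∞] and equals log λ − ∫_Ω f dμ − h^s(μ) (equal to +∞ when h^s(μ) = −∞). -/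

import Mathlib

open MeasureTheory Filter
open scoped Classical

noncomputable section

namespace Paper

variable {A : Type*} [MetricSpace A] [CompactSpace A] [MeasurableSpace A] [BorelSpace A]

/-- The left shift `σ` on `Ω = Aᴺ`. -/
def shift (x : ℕ → A) : ℕ → A := fun n => x (n + 1)

/-- Prepend a symbol: `cons a x = (a, x₀, x₁, …)`. -/
def cons (a : A) (x : ℕ → A) : ℕ → A := fun n =>
  match n with
  | 0 => a
  | n + 1 => x n

/-- The metric `d_Ω` on `Ω`. -/
def dOmega (x y : ℕ → A) : ℝ :=
  ∑' n : ℕ, (1 / 2 : ℝ) ^ (n + 1) * (dist (x n) (y n) / (1 + dist (x n) (y n)))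

/-- `f` is `α`-Hölder with respect to `d_Ω`. -/
def IsHolder (α : ℝ) (f : (ℕ → A) → ℝ) : Prop :=
  ∃ C : ℝ, 0 ≤ C ∧ ∀ x y, |f x - f y| ≤ C * dOmega x y ^ α

/-- The Ruelle transfer operator with a priori measure `p`. -/
def ruelle (p : Measure A) (f φ : (ℕ → A) → ℝ) : (ℕ → A) → ℝ :=
  fun x => ∫ a, Real.exp (f (cons a x)) * φ (cons a x) ∂p

/-- The normalized potential `f̄ = f + log h - log (h ∘ σ) - log λ`. -/
def fbar (f h : (ℕ → A) → ℝ) (lam : ℝ) : (ℕ → A) → ℝ :=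
  fun x => f x + Real.log (h x) - Real.log (h (shift x)) - Real.log lam

/-- Projection on the first `n` coordinates. -/
def proj (n : ℕ) (x : ℕ → A) : Fin n → A := fun i => x i

/-- Relative entropy `H(μ|ν)` of two measures, with value `+∞` unless
`μ ≪ ν` and the entropy integral is finite. -/
def relEnt {X : Type*} [MeasurableSpace X] (μ ν : Measure X) : EReal :=
  if μ ≪ ν ∧ Integrable (fun x => Real.log (μ.rnDeriv ν x).toReal) μ then
    ((∫ x, Real.log (μ.rnDeriv ν x).toReal ∂μ : ℝ) : EReal)
  else ⊤

/-- Relative entropy `H_{Λ_n}(μ|ν)` on the σ-algebra of the first `n` coordinates. -/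
def relEntN (n : ℕ) (μ ν : Measure (ℕ → A)) : EReal :=
  relEnt (μ.map (proj n)) (ν.map (proj n))

/-- The entropy `H_{Λ_n}(μ) = -H_{Λ_n}(μ | pᴺ)` relative to the a priori measure `p`. -/
def finEnt (p : Measure A) (μ : Measure (ℕ → A)) (n : ℕ) : EReal :=
  - relEnt (μ.map (proj n)) (Measure.pi fun _ : Fin n => p)

/-- The specific entropy `h^s(μ) = lim_n H_{Λ_n}(μ)/n` (defined as a `limsup`,
which coincides with the limit whenever the latter exists). -/
def specEnt (p : Measure A) (μ : Measure (ℕ → A)) : EReal :=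
  Filter.atTop.limsup fun n : ℕ => ((n : ℝ)⁻¹ : EReal) * finEnt p μ n

/-- Birkhoff sum `S_n(f)`. -/
def birkhoff (n : ℕ) (f : (ℕ → A) → ℝ) (x : ℕ → A) : ℝ :=
  ∑ i ∈ Finset.range n, f (shift^[i] x)

/-- The configuration `x_{Λ_n} y_{Λ_n^c}`. -/
def concatAt (n : ℕ) (x y : ℕ → A) : ℕ → A := fun i => if i < n then x i else y i

/-- Concatenation of a finite word with a configuration. -/
def wordCons (n : ℕ) (a : Fin n → A) (x : ℕ → A) : ℕ → A :=
  fun i => if h : i < n then a ⟨i, h⟩ else x (i - n)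

/-- `f` belongs to the Walters class:
`sup_{n ≥ 1} sup_{a ∈ Aⁿ} |S_n(f)(ax) - S_n(f)(ay)| → 0` as `d_Ω(x,y) → 0`. -/
def WaltersClass (f : (ℕ → A) → ℝ) : Prop :=
  ∀ ε : ℝ, 0 < ε → ∃ δ : ℝ, 0 < δ ∧ ∀ x y : ℕ → A, dOmega x y < δ →
    ∀ n : ℕ, 1 ≤ n → ∀ a : Fin n → A,
      |birkhoff n f (wordCons n a x) - birkhoff n f (wordCons n a y)| ≤ ε

open InformationTheory

set_option linter.unusedSectionVars false

section RelativeEntropy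

variable {X Y : Type*} [MeasurableSpace X] [MeasurableSpace Y]

/-- For probability measures, `relEnt` is the Kullback-Leibler divergence. -/
lemma relEnt_eq_klDiv (M N : Measure X) [IsProbabilityMeasure M] [IsProbabilityMeasure N] :
    relEnt M N = (klDiv M N : EReal) := by
  unfold relEnt
  split_ifs with hc
  · obtain ⟨hac, hint⟩ := hc
    have h0 := toReal_klDiv_of_measure_eq hac (by simp)
    rw [← ENNReal.ofReal_toReal (klDiv_ne_top hac hint), h0, EReal.coe_ennreal_ofReal,
      max_eq_left (h0 ▸ ENNReal.toReal_nonneg)]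
    rfl
  · have h0 : klDiv M N = ⊤ := by
      by_contra hne
      exact hc (klDiv_ne_top_iff.1 hne)
    simp [h0]

/-- Effect on the relative entropy of tilting the reference measure. -/
lemma relEnt_tilted_right (M P : Measure X) [IsProbabilityMeasure M] [IsProbabilityMeasure P]
    {g : X → ℝ} (hgM : Integrable g M) (hgP : Integrable (fun x => Real.exp (g x)) P)
    (hg1 : ∫ x, Real.exp (g x) ∂P = 1) :
    relEnt M (P.tilted g) = relEnt M P + ((-∫ x, g x ∂M : ℝ) : EReal) := by
  by_cases hc : M ≪ P ∧ Integrable (llr M P) M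
  · obtain ⟨hac, hint⟩ := hc
    have h1 : relEnt M P = ((∫ x, llr M P x ∂M : ℝ) : EReal) := if_pos ⟨hac, hint⟩
    have h2 : relEnt M (P.tilted g) = ((∫ x, llr M (P.tilted g) x ∂M : ℝ) : EReal) :=
      if_pos ⟨hac.trans (absolutelyContinuous_tilted hgP),
        integrable_llr_tilted_right hac hgM hint hgP⟩
    rw [h1, h2, integral_llr_tilted_right hac hgM hgP hint, hg1, Real.log_one, add_zero,
      sub_eq_add_neg, EReal.coe_add]
  · have h1 : relEnt M P = ⊤ := if_neg hc
    have h2 : relEnt M (P.tilted g) = ⊤ := by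
      refine if_neg fun hcc => hc ?_
      have hac : M ≪ P := hcc.1.trans (tilted_absolutelyContinuous P g)
      refine ⟨hac, ?_⟩
      have h3 : Integrable (llr M (P.tilted g)) M := hcc.2
      rw [integrable_congr (llr_tilted_right hac hgP), hg1] at h3
      refine (h3.add hgM).congr (Eventually.of_forall fun x => ?_)
      simp
    rw [h1, h2, EReal.top_add_coe]

/-- The relative entropy with respect to a product measure is superadditive. -/
lemma klDiv_fst_add_klDiv_snd_le [StandardBorelSpace Y] [Nonempty Y] (M : Measure (X × Y))
    [IsProbabilityMeasure M] (P : Measure X) (Q : Measure Y) [IsProbabilityMeasure P]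
    [IsProbabilityMeasure Q] :
    klDiv M.fst P + klDiv M.snd Q ≤ klDiv M (P.prod Q) := by
  have hchain := klDiv_compProd_eq_add M.fst P M.condKernel (ProbabilityTheory.Kernel.const X Q)
  rw [Measure.disintegrate, Measure.compProd_const, Measure.compProd_const] at hchain
  rw [hchain]
  gcongr
  have hmap := klDiv_map_le M (M.fst.prod Q) measurable_snd
  rwa [← Measure.snd, ← Measure.snd, Measure.snd_prod] at hmap

end RelativeEntropy

/-- Fekete's lemma for superadditive sequences with values in `[0, ∞]`. -/
lemma tendsto_div_of_superadditive (r : ℕ → ENNReal) (hr : ∀ m n, r m + r n ≤ r (m + n)) :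
    ∃ L, Tendsto (fun n : ℕ => (n : ENNReal)⁻¹ * r n) atTop (nhds L) := by
  refine ⟨⨆ k : ℕ, ((k : ENNReal) + 1)⁻¹ * r (k + 1), tendsto_of_le_liminf_of_limsup_le ?_ ?_⟩
  · refine iSup_le fun k => ?_
    have hmul : ∀ q s : ℕ, (q : ENNReal) * r (k + 1) ≤ r ((k + 1) * q + s) := by
      intro q s
      induction q with
      | zero => simp
      | succ q ih =>
        calc ((q + 1 : ℕ) : ENNReal) * r (k + 1) = q * r (k + 1) + r (k + 1) := by
              push_cast; ring
          _ ≤ r ((k + 1) * q + s) + r (k + 1) := by gcongr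
          _ ≤ r ((k + 1) * (q + 1) + s) := by
              refine (hr _ _).trans (le_of_eq ?_)
              congr 1; ring
    have hlim : Tendsto (fun n : ℕ => (n : ENNReal)⁻¹ * ((n / (k + 1) : ℕ) : ENNReal)) atTop
        (nhds ((k : ENNReal) + 1)⁻¹) := by
      have h1 : Tendsto (fun n : ℕ => ((n / (k + 1) : ℕ) : ℝ) / (n : ℝ)) atTop
          (nhds ((k + 1 : ℝ)⁻¹)) := by
        have h2 := (tendsto_nat_floor_mul_div_atTop (R := ℝ) (a := ((k : ℝ) + 1)⁻¹)
          (by positivity)).comp tendsto_natCast_atTop_atTop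
        refine h2.congr fun n => ?_
        simp only [Function.comp]
        congr 2
        rw [← Nat.floor_div_eq_div (K := ℝ), div_eq_inv_mul]
        push_cast
        rfl
      have h2 := ENNReal.tendsto_ofReal h1
      have h3 : ENNReal.ofReal ((k + 1 : ℝ)⁻¹) = ((k : ENNReal) + 1)⁻¹ := by
        rw [ENNReal.ofReal_inv_of_pos (by positivity), ENNReal.ofReal_add (by positivity) one_pos.le]
        simp
      rw [h3] at h2
      refine h2.congr' ?_
      filter_upwards [eventually_gt_atTop 0] with n hn
      rw [ENNReal.ofReal_div_of_pos (by exact_mod_cast hn), ENNReal.ofReal_natCast,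
        ENNReal.ofReal_natCast, ENNReal.div_eq_inv_mul]
    have hlim2 := ENNReal.Tendsto.mul_const (b := r (k + 1)) hlim
      (Or.inl (ENNReal.inv_ne_zero.2 (by finiteness)))
    rw [← hlim2.liminf_eq]
    refine liminf_le_liminf (Eventually.of_forall fun n => ?_)
    rw [mul_assoc]
    gcongr
    have := hmul (n / (k + 1)) (n % (k + 1))
    rwa [Nat.div_add_mod] at this
  · refine (limsup_le_limsup (v := fun _ => ⨆ k : ℕ, ((k : ENNReal) + 1)⁻¹ * r (k + 1)) ?_).trans
      (by simp)
    filter_upwards [eventually_gt_atTop 0] with n hn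
    obtain ⟨k, rfl⟩ := Nat.exists_eq_succ_of_ne_zero hn.ne'
    refine le_trans (le_of_eq ?_) (le_iSup _ k)
    push_cast
    rfl

lemma measurable_proj (n : ℕ) : Measurable (proj n : (ℕ → A) → (Fin n → A)) := by
  unfold proj; fun_prop

lemma measurable_shift : Measurable (shift : (ℕ → A) → (ℕ → A)) := by
  unfold shift; fun_prop

lemma continuous_shift : Continuous (shift : (ℕ → A) → (ℕ → A)) := by
  unfold shift; fun_prop

lemma shift_iterate_apply (n : ℕ) (x : ℕ → A) (i : ℕ) : shift^[n] x i = x (i + n) := by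
  induction n generalizing x with
  | zero => rfl
  | succ n ih => rw [Function.iterate_succ_apply, ih, shift]; congr 1

/-- A finite power of a measure splits as the product of two smaller powers. -/
lemma pi_map_split (p : Measure A) [IsProbabilityMeasure p] (m n : ℕ) :
    (Measure.pi fun _ : Fin (m + n) => p).map
      (fun a => (fun i : Fin m => a (Fin.castAdd n i), fun i : Fin n => a (Fin.natAdd m i))) =
    (Measure.pi fun _ : Fin m => p).prod (Measure.pi fun _ : Fin n => p) := by
  have happ : Measurable (fun b : (Fin m → A) × (Fin n → A) => Fin.append b.1 b.2) := by
    refine measurable_pi_lambda _ fun i => ?_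
    refine Fin.addCases (fun i => ?_) (fun i => ?_) i <;> simp <;> fun_prop
  have hpi : Measure.pi (fun _ : Fin (m + n) => p) =
      ((Measure.pi fun _ : Fin m => p).prod (Measure.pi fun _ : Fin n => p)).map
        (fun b => Fin.append b.1 b.2) := by
    refine Measure.pi_eq fun s hs => ?_
    rw [Measure.map_apply happ (MeasurableSet.univ_pi hs)]
    have hpre : (fun b : (Fin m → A) × (Fin n → A) => Fin.append b.1 b.2) ⁻¹' Set.univ.pi s =
        (Set.univ.pi fun i => s (Fin.castAdd n i)) ×ˢ
          (Set.univ.pi fun i => s (Fin.natAdd m i)) := by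
      ext b
      simp [Set.mem_pi, Fin.forall_fin_add]
    rw [hpre, Measure.prod_prod, Measure.pi_pi, Measure.pi_pi, Fin.prod_univ_add]
  rw [hpi, Measure.map_map (by fun_prop) happ]
  convert Measure.map_id
  ext b <;> simp

/-- The relative entropies of the marginals of a shift-invariant measure with respect to
a product measure form a superadditive sequence. -/
lemma klDiv_proj_superadditive (p : Measure A) [IsProbabilityMeasure p]
    (μ : Measure (ℕ → A)) [IsProbabilityMeasure μ] (hinv : μ.map shift = μ) (m n : ℕ) :
    klDiv (μ.map (proj m)) (Measure.pi fun _ : Fin m => p) +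
      klDiv (μ.map (proj n)) (Measure.pi fun _ : Fin n => p) ≤
    klDiv (μ.map (proj (m + n))) (Measure.pi fun _ : Fin (m + n) => p) := by
  have hiter : μ.map shift^[m] = μ :=
    ((⟨measurable_shift, hinv⟩ : MeasurePreserving shift μ μ).iterate m).map_eq
  have : Nonempty (ℕ → A) := ⟨(nonempty_of_isProbabilityMeasure μ).some⟩
  have : Nonempty (Fin n → A) := ⟨proj n this.some⟩
  have := Measure.isProbabilityMeasure_map (μ := μ) (measurable_proj (m + n)).aemeasurable
  let e : (Fin (m + n) → A) → (Fin m → A) × (Fin n → A) := fun a =>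
    (fun i : Fin m => a (Fin.castAdd n i), fun i : Fin n => a (Fin.natAdd m i))
  have he : Measurable e := by fun_prop
  have := Measure.isProbabilityMeasure_map (μ := μ.map (proj (m + n))) he.aemeasurable
  have hle := klDiv_map_le (μ.map (proj (m + n))) (Measure.pi fun _ : Fin (m + n) => p) he
  rw [pi_map_split p m n] at hle
  refine le_trans (le_trans (le_of_eq ?_) (klDiv_fst_add_klDiv_snd_le _ _ _)) hle
  congr 2
  · rw [Measure.fst, Measure.map_map measurable_fst he,
      Measure.map_map (by fun_prop) (measurable_proj _)]
    rfl
  · rw [Measure.snd, Measure.map_map measurable_snd he,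
      Measure.map_map (by fun_prop) (measurable_proj _)]
    conv_lhs => rw [← hiter, Measure.map_map (measurable_proj _) (measurable_shift.iterate m)]
    congr 1
    ext x i
    simp [e, proj, shift_iterate_apply, add_comm]

lemma continuous_cons : Continuous (fun z : A × (ℕ → A) => cons z.1 z.2) := by
  refine continuous_pi fun i => ?_
  cases i with
  | zero => exact continuous_fst
  | succ i => exact (continuous_apply i).comp continuous_snd

lemma measurable_cons : Measurable (fun z : A × (ℕ → A) => cons z.1 z.2) := by
  refine measurable_pi_lambda _ fun i => ?_
  cases i with
  | zero => exact measurable_fst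
  | succ i => exact (measurable_pi_apply i).comp measurable_snd

lemma measurable_wordCons (n : ℕ) :
    Measurable (fun z : (Fin n → A) × (ℕ → A) => wordCons n z.1 z.2) := by
  refine measurable_pi_lambda _ fun i => ?_
  unfold wordCons
  split_ifs <;> fun_prop

lemma wordCons_zero (a : Fin 0 → A) (x : ℕ → A) : wordCons 0 a x = x := by
  ext i; simp [wordCons]

lemma wordCons_succ (n : ℕ) (a : Fin (n + 1) → A) (x : ℕ → A) :
    wordCons (n + 1) a x =
      wordCons n (fun i => a i.castSucc) (cons (a (Fin.last n)) x) := by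
  ext i
  unfold wordCons
  rcases lt_trichotomy i n with hi | rfl | hi
  · simp [hi, hi.trans n.lt_succ_self]
  · simp [cons, Fin.last]
  · obtain ⟨j, rfl⟩ := Nat.exists_eq_add_of_lt hi
    rw [dif_neg (by omega), dif_neg (by omega), show n + j + 1 - n = j + 1 by omega,
      show n + j + 1 - (n + 1) = j by omega, cons]

lemma shift_iterate_wordCons (n : ℕ) (a : Fin n → A) (x : ℕ → A) :
    shift^[n] (wordCons n a x) = x := by
  ext i; simp [shift_iterate_apply, wordCons]

lemma proj_wordCons (n : ℕ) (a : Fin n → A) (x : ℕ → A) : proj n (wordCons n a x) = a := by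
  ext i; simp [proj, wordCons]

lemma birkhoff_succ (n : ℕ) (F : (ℕ → A) → ℝ) (x : ℕ → A) :
    birkhoff (n + 1) F x = birkhoff n F x + F (shift^[n] x) :=
  Finset.sum_range_succ _ _

lemma continuous_birkhoff (n : ℕ) {F : (ℕ → A) → ℝ} (hF : Continuous F) :
    Continuous (birkhoff n F) := by
  unfold birkhoff
  exact continuous_finsetSum _ fun i _ => hF.comp (continuous_shift.iterate i)

/-- A continuous function on the product space depends, up to `ε`, on finitely many coordinates. -/
lemma exists_coord_of_continuous {F : (ℕ → A) → ℝ} (hF : Continuous F) {ε : ℝ} (hε : 0 < ε) :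
    ∃ N : ℕ, ∀ x y : ℕ → A, (∀ i < N, x i = y i) → |F x - F y| < ε := by
  have hu : UniformContinuous F := CompactSpace.uniformContinuous_of_continuous hF
  have hmem := hu (Metric.dist_mem_uniformity hε)
  rw [Filter.mem_map, Pi.uniformity, Filter.mem_iInf] at hmem
  obtain ⟨I, hI, V, hV, hVeq⟩ := hmem
  obtain ⟨N, hN⟩ := hI.bddAbove
  refine ⟨N + 1, fun x y hxy => ?_⟩
  have hxyV : (x, y) ∈ ⋂ i, V i := by
    refine Set.mem_iInter.2 fun i => ?_
    obtain ⟨t, ht, htV⟩ := hV i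
    refine htV ?_
    have hi : x i = y i := hxy i (Nat.lt_succ_of_le (hN i.2))
    rw [Set.mem_preimage]
    dsimp only
    rw [← hi]
    exact refl_mem_uniformity ht
  rw [← hVeq] at hxyV
  simpa [Real.dist_eq] using hxyV

/-- Birkhoff sums of a continuous function vary subextensively on cylinders. -/
lemma birkhoff_variation {F : (ℕ → A) → ℝ} (hF : Continuous F) {ε : ℝ} (hε : 0 < ε) :
    ∃ C : ℝ, ∀ n (x y : ℕ → A), proj n x = proj n y →
      |birkhoff n F x - birkhoff n F y| ≤ n * ε + C := by
  obtain ⟨N, hN⟩ := exists_coord_of_continuous hF hε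
  obtain ⟨M, hM⟩ := isCompact_univ.exists_bound_of_continuousOn hF.continuousOn
  refine ⟨N * (2 * M), fun n x y hxy => ?_⟩
  have hxy' : ∀ i < n, x i = y i := fun i hi => congrFun hxy ⟨i, hi⟩
  have hM2 : ∀ u v, |F u - F v| ≤ 2 * M := fun u v => by
    have h1 := hM u trivial
    have h2 := hM v trivial
    rw [Real.norm_eq_abs] at h1 h2
    linarith [abs_sub (F u) (F v)]
  calc |birkhoff n F x - birkhoff n F y|
      ≤ ∑ i ∈ Finset.range n, |F (shift^[i] x) - F (shift^[i] y)| := by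
        unfold birkhoff
        rw [← Finset.sum_sub_distrib]
        exact Finset.abs_sum_le_sum_abs _ _
    _ ≤ ∑ i ∈ Finset.range n, (ε + if n < i + N then 2 * M else 0) := by
        refine Finset.sum_le_sum fun i _ => ?_
        split_ifs with hi
        · linarith [hM2 (shift^[i] x) (shift^[i] y)]
        · rw [add_zero]
          refine (hN _ _ fun j hj => ?_).le
          rw [shift_iterate_apply, shift_iterate_apply]
          exact hxy' _ (by omega)
    _ ≤ n * ε + N * (2 * M) := by
        rw [Finset.sum_add_distrib, Finset.sum_const, Finset.card_range, nsmul_eq_mul,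
          ← Finset.sum_filter, Finset.sum_const, nsmul_eq_mul]
        gcongr
        · exact (abs_nonneg _).trans (hM2 x x)
        · calc _ ≤ (Finset.Ico (n - N) n).card := by
                refine Finset.card_le_card fun i hi => ?_
                simp only [Finset.mem_filter, Finset.mem_range, Finset.mem_Ico] at hi ⊢
                omega
            _ ≤ N := by rw [Nat.card_Ico]; omega

/-- The integral of a Birkhoff sum against an invariant measure. -/
lemma integral_birkhoff (μ : Measure (ℕ → A)) [IsProbabilityMeasure μ]
    (hinv : μ.map shift = μ) {F : (ℕ → A) → ℝ} (hF : Continuous F) (n : ℕ) :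
    ∫ x, birkhoff n F x ∂μ = n * ∫ x, F x ∂μ := by
  have hmp : ∀ i, μ.map shift^[i] = μ := fun i =>
    ((⟨measurable_shift, hinv⟩ : MeasurePreserving shift μ μ).iterate i).map_eq
  have hi : ∀ i, ∫ x, F (shift^[i] x) ∂μ = ∫ x, F x ∂μ := fun i => by
    conv_rhs => rw [← hmp i, integral_map (measurable_shift.iterate i).aemeasurable
      hF.aestronglyMeasurable]
  unfold birkhoff
  rw [integral_finsetSum]
  · simp [hi]
  · intro i _
    exact (hF.comp (continuous_shift.iterate i)).integrable_of_hasCompactSupport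
      (HasCompactSupport.of_compactSpace _)

/-- An eigenmeasure of the transpose of the Ruelle operator satisfies the eigenmeasure
equation for all nonnegative measurable functions. -/
lemma lintegral_eigenmeasure (p : Measure A) [IsProbabilityMeasure p] {F : (ℕ → A) → ℝ}
    (hF : Continuous F) (ν : Measure (ℕ → A)) [IsProbabilityMeasure ν]
    (hν : ∀ φ : (ℕ → A) → ℝ, Continuous φ → ∫ x, ruelle p F φ x ∂ν = ∫ x, φ x ∂ν)
    {φ : (ℕ → A) → ENNReal} (hφ : Measurable φ) :
    ∫⁻ x, φ x ∂ν =
      ∫⁻ x, ∫⁻ a, ENNReal.ofReal (Real.exp (F (cons a x))) * φ (cons a x) ∂p ∂ν := by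
  let c : (ℕ → A) × A → (ℕ → A) := fun z => cons z.2 z.1
  have hcc : Continuous c := continuous_cons.comp continuous_swap
  have hcm : Measurable c := measurable_cons.comp measurable_swap
  have hGc : Continuous fun z => Real.exp (F (c z)) := Real.continuous_exp.comp (hF.comp hcc)
  have hexp : Measurable fun z => ENNReal.ofReal (Real.exp (F (c z))) :=
    (Real.measurable_exp.comp (hF.measurable.comp hcm)).ennreal_ofReal
  have hint : ∀ g : (ℕ → A) × A → ℝ, Continuous g → Integrable g (ν.prod p) := fun g hg =>
    hg.integrable_of_hasCompactSupport (HasCompactSupport.of_compactSpace _)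
  have hfin : IsFiniteMeasure
      ((ν.prod p).withDensity fun z => ENNReal.ofReal (Real.exp (F (c z)))) :=
    isFiniteMeasure_withDensity_ofReal (hint _ hGc).2
  have hmeas : ν =
      ((ν.prod p).withDensity fun z => ENNReal.ofReal (Real.exp (F (c z)))).map c := by
    refine ext_of_forall_integral_eq_of_IsFiniteMeasure fun φ => ?_
    rw [integral_map hcm.aemeasurable φ.continuous.aestronglyMeasurable,
      integral_withDensity_eq_integral_toReal_smul hexp (by simp), ← hν φ φ.continuous]
    simp only [ENNReal.toReal_ofReal (Real.exp_pos _).le, smul_eq_mul]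
    exact (integral_prod _ (hint _ (hGc.mul (φ.continuous.comp hcc)))).symm
  conv_lhs => rw [hmeas]
  rw [lintegral_map hφ hcm]
  exact (lintegral_withDensity_eq_lintegral_mul _ hexp (hφ.comp hcm)).trans
    (lintegral_prod _ (hexp.mul (hφ.comp hcm)).aemeasurable)

/-- The iterated eigenmeasure equation. -/
lemma lintegral_eigenmeasure_iterate (p : Measure A) [IsProbabilityMeasure p]
    {F : (ℕ → A) → ℝ} (hF : Continuous F) (ν : Measure (ℕ → A)) [IsProbabilityMeasure ν]
    (hν : ∀ φ : (ℕ → A) → ℝ, Continuous φ → ∫ x, ruelle p F φ x ∂ν = ∫ x, φ x ∂ν)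
    (n : ℕ) {φ : (ℕ → A) → ENNReal} (hφ : Measurable φ) :
    ∫⁻ x, φ x ∂ν = ∫⁻ x, ∫⁻ a : Fin n → A,
      ENNReal.ofReal (Real.exp (birkhoff n F (wordCons n a x))) * φ (wordCons n a x)
        ∂(Measure.pi fun _ => p) ∂ν := by
  induction n generalizing φ with
  | zero => simp [wordCons_zero, birkhoff]
  | succ n ih =>
    have hG : Measurable fun y => ENNReal.ofReal (Real.exp (birkhoff n F y)) :=
      (Real.measurable_exp.comp (continuous_birkhoff n hF).measurable).ennreal_ofReal
    have hE : Measurable fun y => ENNReal.ofReal (Real.exp (F y)) :=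
      (Real.measurable_exp.comp hF.measurable).ennreal_ofReal
    have hwc : Measurable fun z : (ℕ → A) × (Fin n → A) => wordCons n z.2 z.1 :=
      (measurable_wordCons n).comp measurable_swap
    have hψ : Measurable fun x => ∫⁻ b : Fin n → A,
        ENNReal.ofReal (Real.exp (birkhoff n F (wordCons n b x))) * φ (wordCons n b x)
        ∂(Measure.pi fun _ => p) :=
      Measurable.lintegral_prod_right' (f := fun z : (ℕ → A) × (Fin n → A) =>
        ENNReal.ofReal (Real.exp (birkhoff n F (wordCons n z.2 z.1))) * φ (wordCons n z.2 z.1))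
        ((hG.comp hwc).mul (hφ.comp hwc))
    rw [ih hφ, lintegral_eigenmeasure p hF ν hν hψ]
    refine lintegral_congr fun x => ?_
    let k : A × (Fin n → A) → ENNReal := fun z =>
      ENNReal.ofReal (Real.exp (F (cons z.1 x))) *
        (ENNReal.ofReal (Real.exp (birkhoff n F (wordCons n z.2 (cons z.1 x)))) *
          φ (wordCons n z.2 (cons z.1 x)))
    have hcx : Measurable fun z : A × (Fin n → A) => cons z.1 x :=
      measurable_cons.comp (measurable_fst.prodMk measurable_const)
    have hwx : Measurable fun z : A × (Fin n → A) => wordCons n z.2 (cons z.1 x) :=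
      (measurable_wordCons n).comp (measurable_snd.prodMk hcx)
    have hk : Measurable k := (hE.comp hcx).mul ((hG.comp hwx).mul (hφ.comp hwx))
    have hmp := measurePreserving_piFinSuccAbove (fun _ : Fin (n + 1) => p) (Fin.last n)
    calc ∫⁻ a, ENNReal.ofReal (Real.exp (F (cons a x))) * ∫⁻ b : Fin n → A,
          ENNReal.ofReal (Real.exp (birkhoff n F (wordCons n b (cons a x)))) *
            φ (wordCons n b (cons a x)) ∂(Measure.pi fun _ => p) ∂p
        = ∫⁻ a, ∫⁻ b : Fin n → A, k (a, b) ∂(Measure.pi fun _ => p) ∂p := by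
          refine lintegral_congr fun a => ?_
          rw [← lintegral_const_mul']
          exact ENNReal.ofReal_ne_top
      _ = ∫⁻ z, k z ∂(p.prod (Measure.pi fun _ : Fin n => p)) :=
          (lintegral_prod _ hk.aemeasurable).symm
      _ = _ := by
          rw [← hmp.lintegral_comp hk]
          refine lintegral_congr fun a => ?_
          have he : (MeasurableEquiv.piFinSuccAbove (fun _ => A) (Fin.last n)) a =
              (a (Fin.last n), fun i : Fin n => a i.castSucc) := by
            ext i
            · rfl
            · simp [MeasurableEquiv.piFinSuccAbove, Fin.init]
          rw [he, wordCons_succ, birkhoff_succ, shift_iterate_wordCons, Real.exp_add,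
            ENNReal.ofReal_mul (Real.exp_pos _).le]
          simp only [k]
          ring

/-- The marginals of the eigenmeasure are tilted product measures, with a tilting function
that is close to the Birkhoff sums. -/
lemma exists_tilted_marginal (p : Measure A) [IsProbabilityMeasure p] {F : (ℕ → A) → ℝ}
    (hF : Continuous F) (ν : Measure (ℕ → A)) [IsProbabilityMeasure ν]
    (hν : ∀ φ : (ℕ → A) → ℝ, Continuous φ → ∫ x, ruelle p F φ x ∂ν = ∫ x, φ x ∂ν) (n : ℕ) :
    ∃ g : (Fin n → A) → ℝ, Measurable g ∧
      ν.map (proj n) = (Measure.pi fun _ => p).tilted g ∧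
      ∫ a, Real.exp (g a) ∂(Measure.pi fun _ => p) = 1 ∧
      ∀ (y : ℕ → A) (V : ℝ), (∀ x, proj n x = proj n y →
        |birkhoff n F x - birkhoff n F y| ≤ V) → |g (proj n y) - birkhoff n F y| ≤ V := by
  let P : Measure (Fin n → A) := Measure.pi fun _ => p
  let E : (Fin n → A) → (ℕ → A) → ℝ := fun a x => Real.exp (birkhoff n F (wordCons n a x))
  let ρ : (Fin n → A) → ℝ := fun a => ∫ x, E a x ∂ν
  have hSc := continuous_birkhoff n hF
  have hEm : Measurable fun z : (Fin n → A) × (ℕ → A) => E z.1 z.2 :=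
    Real.measurable_exp.comp (hSc.measurable.comp (measurable_wordCons n))
  obtain ⟨K, hK⟩ := isCompact_univ.exists_bound_of_continuousOn hSc.continuousOn
  have hEi : ∀ a, Integrable (E a) ν := fun a => by
    refine Integrable.of_bound (hEm.comp measurable_prodMk_left).aestronglyMeasurable
      (Real.exp K) (Eventually.of_forall fun x => ?_)
    rw [Real.norm_eq_abs, abs_of_pos (Real.exp_pos _)]
    exact Real.exp_le_exp.2 ((le_abs_self _).trans (hK _ trivial))
  have hρpos : ∀ a, 0 < ρ a := fun a => integral_exp_pos (hEi a)
  have hρm : Measurable ρ := (hEm.stronglyMeasurable.integral_prod_right').measurable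
  have hexp : ∀ a, Real.exp (Real.log (ρ a)) = ρ a := fun a => Real.exp_log (hρpos a)
  have hdens : ν.map (proj n) = P.withDensity fun a => ENNReal.ofReal (ρ a) := by
    ext B hB
    rw [withDensity_apply _ hB, ← lintegral_indicator_one hB,
      lintegral_map (measurable_one.indicator hB) (measurable_proj n),
      lintegral_eigenmeasure_iterate p hF ν hν n
        (φ := fun x => B.indicator 1 (proj n x))
        ((measurable_one.indicator hB).comp (measurable_proj n)),
      ← lintegral_indicator hB]
    simp only [proj_wordCons]
    rw [lintegral_lintegral_swap]
    · refine lintegral_congr fun a => ?_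
      by_cases ha : a ∈ B
      · simp only [ha, Set.indicator_of_mem, Pi.one_apply, mul_one]
        exact (ofReal_integral_eq_lintegral_ofReal (hEi a)
          (Eventually.of_forall fun x => (Real.exp_pos _).le)).symm
      · simp [ha]
    · exact ((hEm.comp measurable_swap).ennreal_ofReal.mul
        ((measurable_one.indicator hB).comp measurable_snd)).aemeasurable
  have hprob : IsProbabilityMeasure (ν.map (proj n)) :=
    Measure.isProbabilityMeasure_map (measurable_proj n).aemeasurable
  have hlint : ∫⁻ a, ENNReal.ofReal (ρ a) ∂P = 1 := by
    rw [← setLIntegral_univ, ← withDensity_apply _ MeasurableSet.univ, ← hdens, measure_univ]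
  have hint1 : ∫ a, ρ a ∂P = 1 := by
    rw [integral_eq_lintegral_of_nonneg_ae (Eventually.of_forall fun a => (hρpos a).le)
      hρm.aestronglyMeasurable, hlint, ENNReal.toReal_one]
  refine ⟨fun a => Real.log (ρ a), Real.measurable_log.comp hρm, ?_, ?_, ?_⟩
  · simp only [Measure.tilted, hexp]
    rw [hdens, hint1]
    simp [P]
  · simpa only [hexp] using hint1
  · intro y V hV
    have hV' : ∀ x, |birkhoff n F (wordCons n (proj n y) x) - birkhoff n F y| ≤ V := fun x =>
      hV _ (proj_wordCons n _ x)
    have hlow : Real.exp (birkhoff n F y - V) ≤ ρ (proj n y) := by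
      have := integral_mono (μ := ν) (integrable_const (Real.exp (birkhoff n F y - V)))
        (hEi (proj n y)) fun x => Real.exp_le_exp.2 (by linarith [(abs_le.1 (hV' x)).1])
      simpa using this
    have hup : ρ (proj n y) ≤ Real.exp (birkhoff n F y + V) := by
      have := integral_mono (μ := ν) (hEi (proj n y))
        (integrable_const (Real.exp (birkhoff n F y + V)))
        fun x => Real.exp_le_exp.2 (by linarith [(abs_le.1 (hV' x)).2])
      simpa using this
    have h1 := (Real.le_log_iff_exp_le (hρpos _)).2 hlow
    have h2 := (Real.log_le_iff_le_exp (hρpos _)).2 hup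
    exact abs_le.2 ⟨by linarith, by linarith⟩

/-- The specific relative entropy with respect to an eigenmeasure of the transpose of the Ruelle
operator of a continuous potential. -/
lemma tendsto_relEntN (p : Measure A) [IsProbabilityMeasure p] {F : (ℕ → A) → ℝ}
    (hF : Continuous F) (ν : Measure (ℕ → A)) [IsProbabilityMeasure ν]
    (hν : ∀ φ : (ℕ → A) → ℝ, Continuous φ → ∫ x, ruelle p F φ x ∂ν = ∫ x, φ x ∂ν)
    (μ : Measure (ℕ → A)) [IsProbabilityMeasure μ] (hinv : μ.map shift = μ) :
    Tendsto (fun n : ℕ => ((n : ℝ)⁻¹ : EReal) * relEntN n μ ν) atTop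
      (nhds (((-∫ x, F x ∂μ : ℝ) : EReal) - specEnt p μ)) := by
  have hμprob : ∀ n, IsProbabilityMeasure (μ.map (proj n)) := fun n =>
    Measure.isProbabilityMeasure_map (measurable_proj n).aemeasurable
  choose g hgm hgt hg1 hgV using exists_tilted_marginal p hF ν hν
  have hSi : ∀ n, Integrable (birkhoff n F) μ := fun n =>
    (continuous_birkhoff n hF).integrable_of_hasCompactSupport (HasCompactSupport.of_compactSpace _)
  have hgi : ∀ n, Integrable (fun y => g n (proj n y)) μ := fun n => by
    obtain ⟨C, hC⟩ := birkhoff_variation hF one_pos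
    have hd : Integrable (fun y => g n (proj n y) - birkhoff n F y) μ :=
      Integrable.of_bound (((hgm n).comp (measurable_proj n)).sub
        (continuous_birkhoff n hF).measurable).aestronglyMeasurable (n * 1 + C)
        (Eventually.of_forall fun y => hgV n y _ fun x hx => hC n x y hx)
    refine (hd.add (hSi n)).congr (Eventually.of_forall fun y => ?_)
    simp
  have hgi' : ∀ n, Integrable (g n) (μ.map (proj n)) := fun n =>
    (integrable_map_measure (hgm n).aestronglyMeasurable (measurable_proj n).aemeasurable).2 (hgi n)
  set I : ℕ → ℝ := fun n => ∫ a, g n a ∂(μ.map (proj n)) with hI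
  have hIV : ∀ n V, (∀ x y : ℕ → A, proj n x = proj n y →
      |birkhoff n F x - birkhoff n F y| ≤ V) → |I n - n * ∫ x, F x ∂μ| ≤ V := by
    intro n V hV
    rw [hI, ← integral_birkhoff μ hinv hF n]
    dsimp only
    rw [integral_map (measurable_proj n).aemeasurable (hgm n).aestronglyMeasurable,
      ← integral_sub (hgi n) (hSi n)]
    have := norm_integral_le_of_norm_le_const (μ := μ)
      (f := fun y => g n (proj n y) - birkhoff n F y) (C := V)
      (Eventually.of_forall fun y => hgV n y _ fun x hx => hV x y hx)
    simpa using this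
  have hIlim : Tendsto (fun n : ℕ => (n : ℝ)⁻¹ * (-I n)) atTop (nhds (-∫ x, F x ∂μ)) := by
    rw [Metric.tendsto_atTop]
    intro ε hε
    obtain ⟨C, hC⟩ := birkhoff_variation hF (half_pos hε)
    obtain ⟨N, hN⟩ := exists_nat_gt (2 * C / ε)
    refine ⟨N + 1, fun n hn => ?_⟩
    have hn0 : (0 : ℝ) < n := by exact_mod_cast (by omega : 0 < n)
    have hnN : (N : ℝ) ≤ n := by exact_mod_cast (by omega : N ≤ n)
    have hCn : C < n * (ε / 2) := by
      rw [div_lt_iff₀ hε] at hN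
      nlinarith
    have h1 := hIV n _ (hC n)
    have h2 : (n : ℝ)⁻¹ * (-I n) - (-∫ x, F x ∂μ) = -((n : ℝ)⁻¹ * (I n - n * ∫ x, F x ∂μ)) := by
      field_simp
      ring
    rw [Real.dist_eq, h2, abs_neg, abs_mul, abs_of_pos (inv_pos.2 hn0), inv_mul_lt_iff₀ hn0]
    linarith
  have hE : ∀ n, relEntN n μ ν = (klDiv (μ.map (proj n)) (Measure.pi fun _ : Fin n => p) : EReal) +
      ((-I n : ℝ) : EReal) := fun n => by
    have hexpi : Integrable (fun a => Real.exp (g n a)) (Measure.pi fun _ : Fin n => p) :=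
      Integrable.of_integral_ne_zero (by rw [hg1 n]; exact one_ne_zero)
    rw [relEntN, hgt n, relEnt_tilted_right _ _ (hgi' n) hexpi (hg1 n), relEnt_eq_klDiv]
  obtain ⟨L, hL⟩ := tendsto_div_of_superadditive _ (klDiv_proj_superadditive p μ hinv)
  have hcoe : ∀ n : ℕ, 0 < n → (((n : ENNReal)⁻¹ : ENNReal) : EReal) = ((n : ℝ) : EReal)⁻¹ := by
    intro n hn
    rw [← EReal.coe_inv, ← ENNReal.ofReal_natCast, ← ENNReal.ofReal_inv_of_pos (by positivity),
      EReal.coe_ennreal_ofReal, max_eq_left (by positivity)]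
  have hL' : Tendsto (fun n : ℕ => ((n : ℝ)⁻¹ : EReal) *
      (klDiv (μ.map (proj n)) (Measure.pi fun _ : Fin n => p) : EReal)) atTop (nhds (L : EReal)) := by
    refine (EReal.tendsto_coe_ennreal.2 hL).congr' ?_
    filter_upwards [eventually_gt_atTop 0] with n hn
    rw [EReal.coe_ennreal_mul, hcoe n hn]
  have hspec : specEnt p μ = -(L : EReal) := by
    refine Tendsto.limsup_eq ?_
    refine ((continuous_neg.tendsto _).comp hL').congr fun n => ?_
    simp only [Function.comp, finEnt]
    rw [relEnt_eq_klDiv, mul_neg]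
  rw [hspec, sub_eq_add_neg, neg_neg, add_comm]
  have hadd : ContinuousAt (fun q : EReal × EReal => q.1 + q.2)
      ((L : EReal), ((-∫ x, F x ∂μ : ℝ) : EReal)) :=
    EReal.continuousAt_add (Or.inr (EReal.coe_ne_bot _)) (Or.inr (EReal.coe_ne_top _))
  have hIlim' := (continuous_coe_real_ereal.tendsto _).comp hIlim
  refine (hadd.tendsto.comp (hL'.prodMk_nhds hIlim')).congr fun n => ?_
  simp only [Function.comp]
  rw [hE n, ← EReal.coe_inv, EReal.left_distrib_of_nonneg_of_ne_top
    (EReal.coe_nonneg.2 (by positivity)) (EReal.coe_ne_top _), EReal.coe_mul]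

/-- For a continuous potential `f` in the Walters class with eigendata
`(λ, h)` of the Ruelle operator (`h` continuous and strictly positive), `f̄` the associated
normalized potential and `ν` an eigenmeasure of the transpose of `L_{f̄}`, for every
shift-invariant Borel probability measure `μ` the limit `lim_n (1/n) H_{Λ_n}(μ|ν)` exists
and equals `log λ - ∫ f dμ - h^s(μ)`. -/
theorem statement18
    (p : Measure A) [IsProbabilityMeasure p]
    (hsupp : ∀ U : Set A, IsOpen U → U.Nonempty → 0 < p U)
    (f : (ℕ → A) → ℝ) (hfc : Continuous f) (hfw : WaltersClass f)
    (lam : ℝ) (hlam : 0 < lam)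
    (h : (ℕ → A) → ℝ) (hh : Continuous h) (hpos : ∀ x, 0 < h x)
    (heig : ∀ x, ruelle p f h x = lam * h x)
    (ν : Measure (ℕ → A)) [IsProbabilityMeasure ν]
    (hν : ∀ φ : (ℕ → A) → ℝ, Continuous φ →
      ∫ x, ruelle p (fbar f h lam) φ x ∂ν = ∫ x, φ x ∂ν)
    (μ : Measure (ℕ → A)) [IsProbabilityMeasure μ]
    (hinv : μ.map shift = μ) :
    Tendsto (fun n : ℕ => ((n : ℝ)⁻¹ : EReal) * relEntN n μ ν) atTop
      (nhds (((Real.log lam - ∫ x, f x ∂μ : ℝ) : EReal) - specEnt p μ)) := by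
  have hlog : Continuous fun x => Real.log (h x) := hh.log fun x => (hpos x).ne'
  have hlogs : Continuous fun x => Real.log (h (shift x)) := hlog.comp continuous_shift
  have hsum : Continuous fun x => f x + Real.log (h x) := hfc.add hlog
  have hdiff : Continuous fun x => f x + Real.log (h x) - Real.log (h (shift x)) :=
    hsum.sub hlogs
  have hF : Continuous (fbar f h lam) := hdiff.sub continuous_const
  have hint : ∀ u : (ℕ → A) → ℝ, Continuous u → Integrable u μ := fun u hu =>
    hu.integrable_of_hasCompactSupport (HasCompactSupport.of_compactSpace _)
  have hshift : ∫ x, Real.log (h (shift x)) ∂μ = ∫ x, Real.log (h x) ∂μ := by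
    conv_rhs => rw [← hinv, integral_map measurable_shift.aemeasurable hlog.aestronglyMeasurable]
  have hval : -∫ x, fbar f h lam x ∂μ = Real.log lam - ∫ x, f x ∂μ := by
    unfold fbar
    rw [integral_sub (hint _ hdiff) (integrable_const _),
      integral_sub (hint _ hsum) (hint _ hlogs),
      integral_add (hint _ hfc) (hint _ hlog), hshift]
    simp
  rw [← hval]
  exact tendsto_relEntN p hF ν hν μ hinv

end Paper
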